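/- For every integer t ≥ 6 and all positive integers a₁, …, a_t, the complete t-partite graph K_{a₁,…,a_t} is not NIC-planar. -/

import Mathlib

open Set

/-- Two subsets of the plane *properly cross* at a point `p`: in some open
neighbourhood of `p` the pair of sets looks, up to homeomorphism, like the two
coordinate axes meeting at the origin. -/
def ProperCross (A₁ A₂ : Set (ℝ × ℝ)) (p : ℝ × ℝ) : Prop :=
  ∃ U : Set (ℝ × ℝ), IsOpen U ∧ ∃ hp : p ∈ U, ∃ φ : U ≃ₜ (ℝ × ℝ),
    φ ⟨p, hp⟩ = (0, 0) ∧
    (fun x => φ x) '' {x : U | (x : ℝ × ℝ) ∈ A₁} = {q : ℝ × ℝ | q.2 = 0} ∧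
    (fun x => φ x) '' {x : U | (x : ℝ × ℝ) ∈ A₂} = {q : ℝ × ℝ | q.1 = 0}

/-- A drawing of a simple graph `G` in the plane: vertices go to distinct points,
each edge is drawn as a continuous injective arc joining the points of its two
endpoints, no arc passes through the point of a vertex other than its endpoints,
arcs of edges sharing an endpoint meet only at that common point, any two arcs
meet in finitely many points, every intersection point of two arcs that is not a
common endpoint is a proper crossing, and no point of the plane that is not a
vertex point lies on more than two arcs. -/
structure Drawing {V : Type*} (G : SimpleGraph V) where
  pos : V → ℝ × ℝ
  pos_inj : Function.Injective pos
  arc : G.edgeSet → ℝ → ℝ × ℝ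
  arc_cont : ∀ e, ContinuousOn (arc e) (Icc 0 1)
  arc_inj : ∀ e, InjOn (arc e) (Icc 0 1)
  arc_ends : ∀ e : G.edgeSet, ∃ u v : V, (e : Sym2 V) = s(u, v) ∧
    arc e 0 = pos u ∧ arc e 1 = pos v
  no_vertex_interior : ∀ (e : G.edgeSet) (v : V), v ∉ (e : Sym2 V) →
    pos v ∉ arc e '' Icc 0 1
  shared_endpoint : ∀ e₁ e₂ : G.edgeSet, e₁ ≠ e₂ → ∀ v : V,
    v ∈ (e₁ : Sym2 V) → v ∈ (e₂ : Sym2 V) →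
    arc e₁ '' Icc 0 1 ∩ arc e₂ '' Icc 0 1 ⊆ {pos v}
  finite_meet : ∀ e₁ e₂ : G.edgeSet, e₁ ≠ e₂ →
    (arc e₁ '' Icc 0 1 ∩ arc e₂ '' Icc 0 1).Finite
  proper : ∀ e₁ e₂ : G.edgeSet, e₁ ≠ e₂ →
    ∀ p ∈ arc e₁ '' Icc 0 1 ∩ arc e₂ '' Icc 0 1, p ∉ Set.range pos →
    ProperCross (arc e₁ '' Icc 0 1) (arc e₂ '' Icc 0 1) p
  at_most_two : ∀ p : ℝ × ℝ, p ∉ Set.range pos →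
    ∀ e₁ e₂ e₃ : G.edgeSet, p ∈ arc e₁ '' Icc 0 1 → p ∈ arc e₂ '' Icc 0 1 →
      p ∈ arc e₃ '' Icc 0 1 → e₁ = e₂ ∨ e₁ = e₃ ∨ e₂ = e₃

namespace Drawing

variable {V : Type*} {G : SimpleGraph V}

/-- The image of the arc drawn for the edge `e`. -/
def arcIm (D : Drawing G) (e : G.edgeSet) : Set (ℝ × ℝ) :=
  D.arc e '' Icc 0 1

/-- The set of crossings of the drawing: points that are not vertex points and
lie on (at least, hence exactly) two arcs.  (An intersection point of two arcs
that is a common endpoint of the two edges is a vertex point, and conversely a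
vertex point on two arcs is a common endpoint, so these are precisely the
intersection points of pairs of arcs that are not common endpoints.) -/
def crossings (D : Drawing G) : Set (ℝ × ℝ) :=
  {p | p ∉ Set.range D.pos ∧ ∃ e₁ e₂ : G.edgeSet, e₁ ≠ e₂ ∧ p ∈ D.arcIm e₁ ∧ p ∈ D.arcIm e₂}

/-- The number of crossings of the drawing. -/
noncomputable def crossingCount (D : Drawing G) : ℕ := D.crossings.ncard

/-- The cluster set `S(c)` of a crossing `c`: the set of end-vertices of the
(two) edges whose arcs pass through `c`. -/
def cluster (D : Drawing G) (c : ℝ × ℝ) : Set V :=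
  {v | ∃ e : G.edgeSet, c ∈ D.arcIm e ∧ v ∈ (e : Sym2 V)}

/-- A drawing is 1-planar if each edge's arc is crossed at most once. -/
def IsOnePlanar (D : Drawing G) : Prop :=
  ∀ e : G.edgeSet, {p | p ∈ D.crossings ∧ p ∈ D.arcIm e}.Subsingleton

/-- A drawing is NIC-planar if it is 1-planar and the cluster sets of any two
distinct crossings share at most one vertex. -/
def IsNICPlanar (D : Drawing G) : Prop :=
  D.IsOnePlanar ∧ ∀ c₁ ∈ D.crossings, ∀ c₂ ∈ D.crossings, c₁ ≠ c₂ →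
    (D.cluster c₁ ∩ D.cluster c₂).ncard ≤ 1

/-- A drawing is IC-planar if it is 1-planar and the cluster sets of any two
distinct crossings are disjoint. -/
def IsICPlanar (D : Drawing G) : Prop :=
  D.IsOnePlanar ∧ ∀ c₁ ∈ D.crossings, ∀ c₂ ∈ D.crossings, c₁ ≠ c₂ →
    D.cluster c₁ ∩ D.cluster c₂ = ∅

end Drawing

/-- A graph is 1-planar if it admits a 1-planar drawing. -/
def SimpleGraph.OnePlanar {V : Type*} (G : SimpleGraph V) : Prop :=
  ∃ D : Drawing G, D.IsOnePlanar

/-- A graph is NIC-planar if it admits an NIC-planar drawing. -/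
def SimpleGraph.NICPlanar {V : Type*} (G : SimpleGraph V) : Prop :=
  ∃ D : Drawing G, D.IsNICPlanar

/-- A graph is IC-planar if it admits an IC-planar drawing. -/
def SimpleGraph.ICPlanar {V : Type*} (G : SimpleGraph V) : Prop :=
  ∃ D : Drawing G, D.IsICPlanar

/-- The crossing number of `G`: the minimum number of crossings over all
drawings of `G`. -/
noncomputable def SimpleGraph.crossingNumber {V : Type*} (G : SimpleGraph V) : ℕ :=
  sInf {n | ∃ D : Drawing G, D.crossingCount = n}
/-- The graph `H` is a minimum non-NIC-planar graph: `H` is not NIC-planar but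
deleting any single edge of `H` yields an NIC-planar graph. -/
def MinNonNICPlanar {V : Type*} (H : SimpleGraph V) : Prop :=
  ¬ H.NICPlanar ∧ ∀ e ∈ H.edgeSet, (H.deleteEdges {e}).NICPlanar

/-- The graph `H` is a minimum non-IC-planar graph: `H` is not IC-planar but
deleting any single edge of `H` yields an IC-planar graph. -/
def MinNonICPlanar {V : Type*} (H : SimpleGraph V) : Prop :=
  ¬ H.ICPlanar ∧ ∀ e ∈ H.edgeSet, (H.deleteEdges {e}).ICPlanar

/-- The complete multipartite graph with parts of sizes `a 0, …, a (k-1)`. -/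
abbrev completeMultipartite {k : ℕ} (a : Fin k → ℕ) :
    SimpleGraph (Σ i : Fin k, Fin (a i)) :=
  SimpleGraph.completeMultipartiteGraph fun i => Fin (a i)

/-- `G` contains a subgraph isomorphic to `H`, i.e. there is an injective graph
homomorphism from `H` to `G`. -/
def ContainsSubgraphIso {V W : Type*} (G : SimpleGraph V) (H : SimpleGraph W) : Prop :=
  ∃ f : H →g G, Function.Injective f

open Complex in
/-- A continuous nowhere vanishing function on `ℝ` has a continuous logarithm. -/
lemma exists_continuous_log_real {f : ℝ → ℂ} (hf : Continuous f) (h0 : ∀ s, f s ≠ 0) :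
    ∃ F : ℝ → ℂ, Continuous F ∧ ∀ s, exp (F s) = f s := by
  obtain ⟨F, ⟨-, hF⟩, -⟩ := isCoveringMapOn_exp.existsUnique_continuousMap_lifts
    (⟨f, hf⟩ : C(ℝ, ℂ)) (a₀ := 0) (exp_log (h0 0)) (fun a => h0 a)
  exact ⟨F, F.continuous, fun s => congrFun hF s⟩

open Complex in
/-- A continuous nowhere vanishing function on `ℝ × ℝ` has a continuous logarithm. -/
lemma exists_continuous_log_real_prod {f : ℝ × ℝ → ℂ} (hf : Continuous f)
    (h0 : ∀ s, f s ≠ 0) :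
    ∃ F : ℝ × ℝ → ℂ, Continuous F ∧ ∀ s, exp (F s) = f s := by
  obtain ⟨F, ⟨-, hF⟩, -⟩ := isCoveringMapOn_exp.existsUnique_continuousMap_lifts
    (⟨f, hf⟩ : C(ℝ × ℝ, ℂ)) (a₀ := 0) (exp_log (h0 0)) (fun a => h0 a)
  exact ⟨F, F.continuous, fun s => congrFun hF s⟩

open Complex in
/-- Two continuous functions on `ℝ` whose exponentials agree up to a constant factor differ by
a constant. -/
lemma sub_eq_sub_of_exp_eq_mul_exp {F H : ℝ → ℂ} (hF : Continuous F) (hH : Continuous H)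
    (c : ℂ) (h : ∀ s, exp (F s) = c * exp (H s)) (a b : ℝ) : F a - F b = H a - H b := by
  have hE : ∀ s, exp (F s) = exp (H s + (F b - H b)) := by
    intro s
    rw [exp_add, exp_sub, h, h b]
    field_simp [exp_ne_zero]
  have key := Complex.isCoveringMap_exp.eq_of_comp_eq (g₁ := F) (g₂ := fun s => H s + (F b - H b)) hF
    (by fun_prop) (by funext s; exact Subtype.ext (hE s)) b (by ring)
  have := congrFun key a
  rw [this]; ring

/-- In a complete graph on five vertices mapped continuously to the plane, two disjoint edges
have intersecting images. -/
theorem exists_disjoint_edges_meet (p : Fin 5 → ℂ) (γ : Fin 5 → Fin 5 → ℝ → ℂ)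
    (hc : ∀ u v, u ≠ v → Continuous (γ u v))
    (h0 : ∀ u v, u ≠ v → γ u v 0 = p u) (h1 : ∀ u v, u ≠ v → γ u v 1 = p v) :
    ∃ u v x y, u ≠ v ∧ u ≠ x ∧ u ≠ y ∧ v ≠ x ∧ v ≠ y ∧ x ≠ y ∧
      ∃ s t, γ u v s = γ x y t := by
  by_contra! hd
  have hother : ∀ u v x : Fin 5, ∃ y, u ≠ y ∧ v ≠ y ∧ x ≠ y := by decide
  have hvert : ∀ u v x, u ≠ v → u ≠ x → v ≠ x → ∀ s, γ u v s - p x ≠ 0 := by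
    intro u v x huv hux hvx s
    obtain ⟨y, huy, hvy, hxy⟩ := hother u v x
    rw [← h0 x y hxy]
    exact sub_ne_zero.2 (hd u v x y huv hux huy hvx hvy hxy s 0)
  have hpp : ∀ u x, u ≠ x → p u - p x ≠ 0 := by
    intro u x hux
    obtain ⟨v, huv, hxv, -⟩ := hother u x u
    rw [← h0 u v huv]
    exact hvert u v x huv hux hxv.symm 0
  -- logarithms of the vertex differences, antisymmetric up to `π * I`
  obtain ⟨A, hA, hAlt⟩ : ∃ A : Fin 5 → Fin 5 → ℂ,
      (∀ u x, u ≠ x → Complex.exp (A u x) = p u - p x) ∧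
      (∀ u x, u ≠ x → A x u = A u x + Real.pi * Complex.I * (if u < x then 1 else -1 : ℤ)) := by
    refine ⟨fun u x => if u < x then Complex.log (p u - p x)
      else Complex.log (p x - p u) + Real.pi * Complex.I, fun u x hux => ?_, fun u x hux => ?_⟩
    · dsimp only
      split_ifs
      · exact Complex.exp_log (hpp u x hux)
      · rw [Complex.exp_add, Complex.exp_log (hpp x u hux.symm), Complex.exp_pi_mul_I]
        ring
    · rcases lt_or_gt_of_ne hux with h | h
      · simp [h, h.not_gt]
      · simp [h, h.not_gt]
  have hlog : ∀ u v x, ∃ L : ℝ → ℂ, u ≠ v → u ≠ x → v ≠ x →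
      Continuous L ∧ ∀ s, Complex.exp (L s) = γ u v s - p x := by
    intro u v x
    by_cases h : u ≠ v ∧ u ≠ x ∧ v ≠ x
    · obtain ⟨L, hL⟩ := exists_continuous_log_real (f := fun s => γ u v s - p x)
        ((hc u v h.1).sub continuous_const) (hvert u v x h.1 h.2.1 h.2.2)
      exact ⟨L, fun _ _ _ => hL⟩
    · exact ⟨0, fun a b c => (h ⟨a, b, c⟩).elim⟩
  choose L hL using hlog
  have hn : ∀ u v x, ∃ n : ℤ, u ≠ v → u ≠ x → v ≠ x →
      L u v x 1 - L u v x 0 = A v x - A u x + n * (2 * Real.pi * Complex.I) := by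
    intro u v x
    by_cases h : u ≠ v ∧ u ≠ x ∧ v ≠ x
    · obtain ⟨huv, hux, hvx⟩ := h
      have hE := (hL u v x huv hux hvx).2
      have : Complex.exp (L u v x 1 - L u v x 0) = Complex.exp (A v x - A u x) := by
        rw [Complex.exp_sub, Complex.exp_sub, hE, hE, hA _ _ hux, hA _ _ hvx, h0 _ _ huv,
          h1 _ _ huv]
      obtain ⟨n, hn⟩ := Complex.exp_eq_exp_iff_exists_int.1 this
      exact ⟨n, fun _ _ _ => hn⟩
    · exact ⟨0, fun a b c => (h ⟨a, b, c⟩).elim⟩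
  choose n hn using hn
  have key : ∀ u v x y, u ≠ v → u ≠ x → u ≠ y → v ≠ x → v ≠ y → x ≠ y →
      2 * (n u v x - n u v y - n x y u + n x y v) =
        (if u < y then 1 else -1) - (if u < x then 1 else -1)
        - (if v < y then 1 else -1) + (if v < x then 1 else -1 : ℤ) := by
    intro u v x y huv hux huy hvx hvy hxy
    obtain ⟨F, hF, hFe⟩ := exists_continuous_log_real_prod
      (f := fun q : ℝ × ℝ => γ u v q.1 - γ x y q.2)
      (((hc u v huv).comp continuous_fst).sub ((hc x y hxy).comp continuous_snd))
      (fun q => sub_ne_zero.2 (hd u v x y huv hux huy hvx hvy hxy q.1 q.2))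
    have e1 := sub_eq_sub_of_exp_eq_mul_exp (F := fun s => F (s, 0)) (by fun_prop)
      (hL u v x huv hux hvx).1 1
      (fun s => by simp [hFe, (hL u v x huv hux hvx).2, h0 x y hxy]) 1 0
    have e2 := sub_eq_sub_of_exp_eq_mul_exp (F := fun s => F (s, 1)) (by fun_prop)
      (hL u v y huv huy hvy).1 1
      (fun s => by simp [hFe, (hL u v y huv huy hvy).2, h1 x y hxy]) 1 0
    have e3 := sub_eq_sub_of_exp_eq_mul_exp (F := fun s => F (0, s)) (by fun_prop)
      (hL x y u hxy hux.symm huy.symm).1 (-1)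
      (fun s => by simp [hFe, (hL x y u hxy hux.symm huy.symm).2, h0 u v huv]) 1 0
    have e4 := sub_eq_sub_of_exp_eq_mul_exp (F := fun s => F (1, s)) (by fun_prop)
      (hL x y v hxy hvx.symm hvy.symm).1 (-1)
      (fun s => by simp [hFe, (hL x y v hxy hvx.symm hvy.symm).2, h1 u v huv]) 1 0
    rw [hn u v x huv hux hvx] at e1
    rw [hn u v y huv huy hvy] at e2
    rw [hn x y u hxy hux.symm huy.symm, hAlt u x hux, hAlt u y huy] at e3
    rw [hn x y v hxy hvx.symm hvy.symm, hAlt v x hvx, hAlt v y hvy] at e4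
    have hpi : (Real.pi * Complex.I : ℂ) ≠ 0 := by simp [Real.pi_ne_zero]
    have : ((2 * (n u v x - n u v y - n x y u + n x y v) : ℤ) : ℂ) =
        (((if u < y then 1 else -1) - (if u < x then 1 else -1)
        - (if v < y then 1 else -1) + (if v < x then 1 else -1) : ℤ) : ℂ) := by
      apply mul_left_cancel₀ hpi
      simp only [Int.cast_add, Int.cast_sub, Int.cast_mul, Int.cast_ofNat]
      linear_combination e2 + e3 - e1 - e4
    exact_mod_cast this
  have k01 := key 0 1 2 3 (by decide) (by decide) (by decide) (by decide) (by decide) (by decide)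
  have k02 := key 0 2 1 3 (by decide) (by decide) (by decide) (by decide) (by decide) (by decide)
  have k03 := key 0 3 1 2 (by decide) (by decide) (by decide) (by decide) (by decide) (by decide)
  have k11 := key 0 1 2 4 (by decide) (by decide) (by decide) (by decide) (by decide) (by decide)
  have k12 := key 0 2 1 4 (by decide) (by decide) (by decide) (by decide) (by decide) (by decide)
  have k13 := key 0 4 1 2 (by decide) (by decide) (by decide) (by decide) (by decide) (by decide)
  have k21 := key 0 1 3 4 (by decide) (by decide) (by decide) (by decide) (by decide) (by decide)
  have k22 := key 0 3 1 4 (by decide) (by decide) (by decide) (by decide) (by decide) (by decide)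
  have k23 := key 0 4 1 3 (by decide) (by decide) (by decide) (by decide) (by decide) (by decide)
  have k31 := key 0 2 3 4 (by decide) (by decide) (by decide) (by decide) (by decide) (by decide)
  have k32 := key 0 3 2 4 (by decide) (by decide) (by decide) (by decide) (by decide) (by decide)
  have k33 := key 0 4 2 3 (by decide) (by decide) (by decide) (by decide) (by decide) (by decide)
  have k41 := key 1 2 3 4 (by decide) (by decide) (by decide) (by decide) (by decide) (by decide)
  have k42 := key 1 3 2 4 (by decide) (by decide) (by decide) (by decide) (by decide) (by decide)
  have k43 := key 1 4 2 3 (by decide) (by decide) (by decide) (by decide) (by decide) (by decide)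
  simp (decide := true) only [if_true, if_false] at k01 k02 k03 k11 k12 k13 k21 k22 k23
  simp (decide := true) only [if_true, if_false] at k31 k32 k33 k41 k42 k43
  omega

namespace Drawing

variable {V : Type*} {G : SimpleGraph V}

/-- The arc of an edge `uv`, parametrized over `ℝ` from `u` to `v`. -/
lemma exists_continuous_param (D : Drawing G) {u v : V} (h : G.Adj u v) :
    ∃ g : ℝ → ℝ × ℝ, Continuous g ∧ g 0 = D.pos u ∧ g 1 = D.pos v ∧
      ∀ s, g s ∈ D.arcIm ⟨s(u, v), h⟩ := by
  set e : G.edgeSet := ⟨s(u, v), h⟩ with he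
  have hcont : Continuous fun s : ℝ => D.arc e (projIcc 0 1 zero_le_one s) :=
    (continuousOn_iff_continuous_domRestrict.1 (D.arc_cont e)).comp continuous_projIcc
  have hmem : ∀ s : ℝ, D.arc e (projIcc 0 1 zero_le_one s) ∈ D.arcIm e :=
    fun s => mem_image_of_mem _ (projIcc 0 1 zero_le_one s).2
  obtain ⟨a, b, hab, h0, h1⟩ := D.arc_ends e
  rcases Sym2.eq_iff.1 (show s(u, v) = s(a, b) from hab) with ⟨rfl, rfl⟩ | ⟨rfl, rfl⟩
  · exact ⟨_, hcont, by simpa using h0, by simpa using h1, hmem⟩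
  · exact ⟨fun s => D.arc e (projIcc 0 1 zero_le_one (1 - s)),
      hcont.comp (continuous_const.sub continuous_id), by simpa using h1, by simpa using h0,
      fun s => hmem (1 - s)⟩

/-- Among any five pairwise adjacent vertices, two disjoint edges have intersecting arcs. -/
lemma exists_arcs_meet (D : Drawing G) (w : Fin 5 → V)
    (hw : ∀ i j, i ≠ j → G.Adj (w i) (w j)) :
    ∃ (i j k l : Fin 5) (hij : i ≠ j) (hkl : k ≠ l) (c : ℝ × ℝ),
      i ≠ k ∧ i ≠ l ∧ j ≠ k ∧ j ≠ l ∧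
      c ∈ D.arcIm ⟨s(w i, w j), hw i j hij⟩ ∧ c ∈ D.arcIm ⟨s(w k, w l), hw k l hkl⟩ := by
  have hg : ∀ i j, ∃ g : ℝ → ℝ × ℝ, ∀ h : i ≠ j, Continuous g ∧ g 0 = D.pos (w i) ∧
      g 1 = D.pos (w j) ∧ ∀ s, g s ∈ D.arcIm ⟨s(w i, w j), hw i j h⟩ := by
    intro i j
    by_cases h : i ≠ j
    · obtain ⟨g, hg⟩ := D.exists_continuous_param (hw i j h)
      exact ⟨g, fun _ => hg⟩
    · exact ⟨0, fun h' => (h h').elim⟩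
  choose g hg using hg
  let φ := Complex.equivRealProdCLM.symm
  obtain ⟨i, j, k, l, hij, hik, hil, hjk, hjl, hkl, s, t, hst⟩ :=
    exists_disjoint_edges_meet (fun i => φ (D.pos (w i))) (fun i j s => φ (g i j s))
      (fun i j h => φ.continuous.comp (hg i j h).1)
      (fun i j h => congrArg φ (hg i j h).2.1)
      (fun i j h => congrArg φ (hg i j h).2.2.1)
  refine ⟨i, j, k, l, hij, hkl, g i j s, hik, hil, hjk, hjl, (hg i j hij).2.2.2 s, ?_⟩
  rw [φ.injective hst]
  exact (hg k l hkl).2.2.2 t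

/-- A point on the arcs of two disjoint edges is not a vertex point. -/
lemma notMem_range_pos (D : Drawing G) {e₁ e₂ : G.edgeSet}
    (h : ∀ v, v ∈ (e₁ : Sym2 V) → v ∉ (e₂ : Sym2 V)) {c : ℝ × ℝ}
    (h₁ : c ∈ D.arcIm e₁) (h₂ : c ∈ D.arcIm e₂) : c ∉ Set.range D.pos := by
  rintro ⟨v, rfl⟩
  by_cases hv : v ∈ (e₁ : Sym2 V)
  · exact D.no_vertex_interior e₂ v (h v hv) h₂
  · exact D.no_vertex_interior e₁ v hv h₁

end Drawing

/-- A graph with six pairwise adjacent vertices is not NIC-planar. -/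
theorem not_nicPlanar_of_six_pairwise_adj {V : Type*} [Finite V] (G : SimpleGraph V)
    (w : Fin 6 → V) (hw : ∀ i j, i ≠ j → G.Adj (w i) (w j)) : ¬ G.NICPlanar := by
  rintro ⟨D, -, hD⟩
  have hinj : Function.Injective w := fun i j h => by
    by_contra hij
    exact (hw i j hij).ne h
  have step : ∀ m : Fin 6, ∃ (i j k l : Fin 6) (hij : i ≠ j) (hkl : k ≠ l) (c : ℝ × ℝ),
      (i ≠ m ∧ j ≠ m ∧ k ≠ m ∧ l ≠ m) ∧ (i ≠ k ∧ i ≠ l ∧ j ≠ k ∧ j ≠ l) ∧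
      c ∈ D.arcIm ⟨s(w i, w j), hw i j hij⟩ ∧ c ∈ D.arcIm ⟨s(w k, w l), hw k l hkl⟩ ∧
      c ∈ D.crossings := by
    intro m
    have hs := Fin.succAbove_right_injective (p := m)
    obtain ⟨i, j, k, l, hij, hkl, c, hik, hil, hjk, hjl, h₁, h₂⟩ :=
      D.exists_arcs_meet (fun i => w (m.succAbove i)) (fun i j h => hw _ _ (hs.ne h))
    refine ⟨_, _, _, _, hs.ne hij, hs.ne hkl, c, ⟨m.succAbove_ne i, m.succAbove_ne j,
      m.succAbove_ne k, m.succAbove_ne l⟩, ⟨hs.ne hik, hs.ne hil, hs.ne hjk, hs.ne hjl⟩, h₁, h₂,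
      D.notMem_range_pos ?_ h₁ h₂, _, _, ?_, h₁, h₂⟩
    · simp [hinj.eq_iff, hs.eq_iff, hik, hil, hjk, hjl]
    · simp [Subtype.ext_iff, hinj.eq_iff, hs.eq_iff, hik, hil]
  have hsub : ∀ (i j k l : Fin 6) (hij : i ≠ j) (hkl : k ≠ l) (c : ℝ × ℝ),
      c ∈ D.arcIm ⟨s(w i, w j), hw i j hij⟩ → c ∈ D.arcIm ⟨s(w k, w l), hw k l hkl⟩ →
      w '' (({i, j, k, l} : Finset (Fin 6)) : Set (Fin 6)) ⊆ D.cluster c := by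
    rintro i j k l hij hkl c h₁ h₂ _ ⟨x, hx, rfl⟩
    simp only [Finset.coe_insert, Finset.coe_singleton, mem_insert_iff,
      mem_singleton_iff] at hx
    rcases hx with rfl | rfl | rfl | rfl
    · exact ⟨_, h₁, by simp⟩
    · exact ⟨_, h₁, by simp⟩
    · exact ⟨_, h₂, by simp⟩
    · exact ⟨_, h₂, by simp⟩
  obtain ⟨i, j, k, l, hij, hkl, c, -, ⟨hik, hil, hjk, hjl⟩, h₁, h₂, hc⟩ := step 0
  obtain ⟨i', j', k', l', hij', hkl', c', ⟨hi, hj, hk, hl⟩, ⟨hik', hil', hjk', hjl'⟩,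
    h₁', h₂', hc'⟩ := step i
  have hne : c ≠ c' := by
    rintro rfl
    rcases D.at_most_two c hc.1 _ _ _ h₁ h₁' h₂' with h | h | h <;>
      have h := Sym2.eq_iff.1 (congrArg Subtype.val h) <;>
      simp only [hinj.eq_iff] at h <;> grind
  have hcap := hD c hc c' hc' hne
  let S : Finset (Fin 6) := {i, j, k, l}
  let T : Finset (Fin 6) := {i', j', k', l'}
  have hS : S.card = 4 := by
    simp [S, hij, hik, hil, hjk, hjl, hkl]
  have hT : T.card = 4 := by
    simp [T, hij', hik', hil', hjk', hjl', hkl']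
  have hST := Finset.card_union_add_card_inter S T
  have hU : (S ∪ T).card ≤ 6 := (Finset.card_le_univ _).trans (by simp)
  have hle : (S ∩ T).card ≤ (D.cluster c ∩ D.cluster c').ncard := by
    rw [← Set.ncard_coe_finset, ← Set.ncard_image_of_injective _ hinj]
    refine Set.ncard_le_ncard ?_ (Set.toFinite _)
    rw [Finset.coe_inter]
    exact (Set.image_inter_subset _ _ _).trans
      (Set.inter_subset_inter (hsub i j k l hij hkl c h₁ h₂)
        (hsub i' j' k' l' hij' hkl' c' h₁' h₂'))
  omega

/-- no complete `t`-partite graph with `t ≥ 6` (all parts nonempty)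
is NIC-planar. -/
theorem stmt9 (t : ℕ) (ht : 6 ≤ t) (a : Fin t → ℕ) (ha : ∀ i, 0 < a i) :
    ¬ (completeMultipartite a).NICPlanar := by
  refine not_nicPlanar_of_six_pairwise_adj _
    (fun i => ⟨Fin.castLE ht i, ⟨0, ha _⟩⟩) (fun i j hij => ?_)
  simpa [SimpleGraph.completeMultipartiteGraph] using hij
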